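/- (Sobolev inequality on hyperboloids.) There is a constant C > 0 such that for every smooth function u defined on {(t,x) : t ≥ 2} and supported in {(t,x) : |x| < t − 1}, every s ≥ 2, and every (t,x) ∈ H_s, one has t^{3/2} |u(t,x)| ≤ C Σ_{|J| ≤ 2} ‖L^J u‖_{L²_f(H_s)}, where the sum runs over all compositions L^J of at most 2 Lorentz boosts L_a. -/

import Mathlib

open MeasureTheory Real
noncomputable section

def pder (α : Fin 4) (φ : (Fin 4 → ℝ) → ℝ) (y : Fin 4 → ℝ) : ℝ :=
  fderiv ℝ φ y (Pi.single α 1)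

def Lb (a : Fin 3) (φ : (Fin 4 → ℝ) → ℝ) (y : Fin 4 → ℝ) : ℝ :=
  y a.succ * pder 0 φ y + y 0 * pder a.succ φ y

def rotVF (a b : Fin 3) (φ : (Fin 4 → ℝ) → ℝ) (y : Fin 4 → ℝ) : ℝ :=
  y a.succ * pder b.succ φ y - y b.succ * pder a.succ φ y

def Box (φ : (Fin 4 → ℝ) → ℝ) (y : Fin 4 → ℝ) : ℝ :=
  - pder 0 (pder 0 φ) y + ∑ a : Fin 3, pder a.succ (pder a.succ φ) y

inductive VF : Type
  | pd : Fin 4 → VF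
  | boost : Fin 3 → VF
  | rot : Fin 3 → Fin 3 → VF
  deriving DecidableEq, Fintype

def VF.apply : VF → ((Fin 4 → ℝ) → ℝ) → ((Fin 4 → ℝ) → ℝ)
  | .pd α, φ => pder α φ
  | .boost a, φ => Lb a φ
  | .rot a b, φ => rotVF a b φ

def applyComp {n : ℕ} (Γ : Fin n → VF) (φ : (Fin 4 → ℝ) → ℝ) : (Fin 4 → ℝ) → ℝ :=
  (List.ofFn Γ).foldr VF.apply φ

def spt (t : ℝ) (x : Fin 3 → ℝ) : Fin 4 → ℝ := Fin.cons t x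
def rad (x : Fin 3 → ℝ) : ℝ := Real.sqrt (∑ i, x i ^ 2)
def L2normSq (g : (Fin 3 → ℝ) → ℝ) : ℝ := ∫ x : Fin 3 → ℝ, g x ^ 2
def L2norm (g : (Fin 3 → ℝ) → ℝ) : ℝ := Real.sqrt (L2normSq g)

def pderx (a : Fin 3) (g : (Fin 3 → ℝ) → ℝ) (x : Fin 3 → ℝ) : ℝ :=
  fderiv ℝ g x (Pi.single a 1)
def pderxIter (k : Fin 3 → ℕ) (g : (Fin 3 → ℝ) → ℝ) : (Fin 3 → ℝ) → ℝ :=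
  (pderx 0)^[k 0] ((pderx 1)^[k 1] ((pderx 2)^[k 2] g))
def sobNormSq (N : ℕ) (g : (Fin 3 → ℝ) → ℝ) : ℝ :=
  ∑ k ∈ Finset.univ.filter (fun k : Fin 3 → Fin (N+1) => ∑ i, (k i : ℕ) ≤ N),
    L2normSq (pderxIter (fun i => (k i : ℕ)) g)
def sobNorm (N : ℕ) (g : (Fin 3 → ℝ) → ℝ) : ℝ := Real.sqrt (sobNormSq N g)

def hypPoint (s : ℝ) (x : Fin 3 → ℝ) : Fin 4 → ℝ := spt (Real.sqrt (s^2 + ∑ i, x i ^ 2)) x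
def hypL2Sq (s : ℝ) (φ : (Fin 4 → ℝ) → ℝ) : ℝ := ∫ x : Fin 3 → ℝ, (φ (hypPoint s x))^2
def hypEnergy (μ s : ℝ) (φ : (Fin 4 → ℝ) → ℝ) : ℝ :=
  ∫ x : Fin 3 → ℝ,
    ((pder 0 φ (hypPoint s x))^2 + ∑ a : Fin 3, (pder a.succ φ (hypPoint s x))^2
      + 2 * ∑ a : Fin 3, (x a / hypPoint s x 0) * pder 0 φ (hypPoint s x) * pder a.succ φ (hypPoint s x)
      + μ^2 * (φ (hypPoint s x))^2)

def flatEnergy (μ t : ℝ) (φ : (Fin 4 → ℝ) → ℝ) : ℝ :=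
  (∑ α : Fin 4, L2normSq (fun x => pder α φ (spt t x))) + μ^2 * L2normSq (fun x => φ (spt t x))

def Xnorm (N : ℕ) (δ m : ℝ) (φ ψ : (Fin 4 → ℝ) → ℝ) : ℝ :=
  (⨆ t : {t : ℝ // 2 ≤ t}, ∑ n ∈ Finset.range (N+1), ∑ Γs : Fin n → VF,
    (flatEnergy 1 t (applyComp Γs φ) + (t : ℝ) ^ (-δ) * flatEnergy 1 t (applyComp Γs ψ)))
  + (⨆ s : {s : ℝ // 2 ≤ s}, ∑ n ∈ Finset.range (N - 5 + 1), ∑ Γs : Fin n → VF,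
    (Real.sqrt (hypEnergy m s (applyComp Γs φ))
      + (s : ℝ) ^ (-δ) * Real.sqrt (hypEnergy 1 s (applyComp Γs ψ))))

/-- Composition of Lorentz boosts `L^J = L_{a₁} ∘ ⋯ ∘ L_{aₙ}`. -/
def applyBoosts {n : ℕ} (J : Fin n → Fin 3) (φ : (Fin 4 → ℝ) → ℝ) : (Fin 4 → ℝ) → ℝ :=
  (List.ofFn J).foldr Lb φ

open Set intervalIntegral in
theorem sq_intervalIntegral_le {h : ℝ → ℝ} (hh : Continuous h) {R : ℝ} (hR : 0 < R) :
    (∫ r in (0 : ℝ)..R, h r) ^ 2 ≤ R * ∫ r in (0 : ℝ)..R, h r ^ 2 := by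
  set c := (∫ r in (0 : ℝ)..R, h r) / R with hc
  have h0 : 0 ≤ ∫ r in (0 : ℝ)..R, (h r - c) ^ 2 :=
    integral_nonneg hR.le fun r _ => sq_nonneg _
  have h1 : ∫ r in (0 : ℝ)..R, (h r - c) ^ 2
      = (∫ r in (0 : ℝ)..R, h r ^ 2) - 2 * c * (∫ r in (0 : ℝ)..R, h r) + R * c ^ 2 := by
    have : ∀ r, (h r - c) ^ 2 = h r ^ 2 - 2 * c * h r + c ^ 2 := fun r => by ring
    simp_rw [this]
    rw [integral_add (Continuous.intervalIntegrable (by fun_prop) _ _)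
      (Continuous.intervalIntegrable (by fun_prop) _ _),
      intervalIntegral.integral_sub (Continuous.intervalIntegrable (by fun_prop) _ _)
      (Continuous.intervalIntegrable (by fun_prop) _ _), intervalIntegral.integral_const_mul]
    simp
  have h2 : ∫ r in (0 : ℝ)..R, h r = R * c := by rw [hc]; field_simp
  rw [h1, h2] at h0
  rw [h2]
  nlinarith

open Set intervalIntegral in
theorem sq_le_integral_sq_mul_of_hasDerivAt {f f' f'' q : ℝ → ℝ} {R : ℝ} (hR : 0 < R)
    (hf : ∀ r, HasDerivAt f (f' r) r) (hf' : ∀ r, HasDerivAt f' (f'' r) r)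
    (hf'' : Continuous f'') (hq : Continuous q)
    (hle : ∀ r ∈ Icc 0 R, (2 / R ^ 2 * |f r| + 4 / R * |f' r| + |f'' r|) ^ 2 ≤ q r) :
    f 0 ^ 2 ≤ R * ∫ r in (0 : ℝ)..R, r ^ 2 * q r := by
  have cf : Continuous f := continuous_iff_continuousAt.2 fun r => (hf r).continuousAt
  have cf' : Continuous f' := continuous_iff_continuousAt.2 fun r => (hf' r).continuousAt
  set w : ℝ → ℝ := fun r => (1 - r / R) ^ 2 * f r
  set w' : ℝ → ℝ := fun r => -(2 / R) * (1 - r / R) * f r + (1 - r / R) ^ 2 * f' r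
  set w'' : ℝ → ℝ := fun r =>
    2 / R ^ 2 * f r - 4 / R * (1 - r / R) * f' r + (1 - r / R) ^ 2 * f'' r
  have hl : ∀ r : ℝ, HasDerivAt (fun r : ℝ => 1 - r / R) (-(1 / R)) r := fun r => by
    simpa using ((hasDerivAt_id r).div_const R).const_sub 1
  have hw : ∀ r, HasDerivAt w (w' r) r := fun r => by
    refine (((hl r).fun_pow 2).mul (hf r)).congr_deriv ?_
    simp only [w']; push_cast; ring
  have hw' : ∀ r, HasDerivAt w' (w'' r) r := fun r => by
    refine ((((hl r).const_mul (-(2 / R))).mul (hf r)).add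
      (((hl r).fun_pow 2).mul (hf' r))).congr_deriv ?_
    simp only [w'']; push_cast; field_simp; ring
  have cw'' : Continuous w'' := by fun_prop
  have key : ∫ r in (0 : ℝ)..R, r * w'' r = f 0 := by
    rw [integral_eq_sub_of_hasDerivAt (f := fun r => r * w' r - w r)]
    · simp [w, w', hR.ne']
    · intro r _
      exact (((hasDerivAt_id r).mul (hw' r)).sub (hw r)).congr_deriv (by simp)
    · exact Continuous.intervalIntegrable (by fun_prop) _ _
  calc f 0 ^ 2 ≤ R * ∫ r in (0 : ℝ)..R, (r * w'' r) ^ 2 := by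
        rw [← key]; exact sq_intervalIntegral_le (by fun_prop) hR
    _ ≤ R * ∫ r in (0 : ℝ)..R, r ^ 2 * q r := by
        gcongr
        refine integral_mono_on hR.le (Continuous.intervalIntegrable (by fun_prop) _ _)
          (Continuous.intervalIntegrable (by fun_prop) _ _) fun r hr => ?_
        rw [mul_pow]
        gcongr
        refine le_trans ?_ (hle r hr)
        rw [← sq_abs]
        gcongr
        have e0 : 0 ≤ 1 - r / R := by rw [sub_nonneg, div_le_one hR]; exact hr.2
        have e1 : 1 - r / R ≤ 1 := by
          have := div_nonneg hr.1 hR.le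
          linarith
        refine (abs_add_le _ _).trans (add_le_add ((abs_sub _ _).trans (add_le_add ?_ ?_)) ?_)
        · rw [abs_mul, abs_of_pos (by positivity : 0 < 2 / R ^ 2)]
        · rw [abs_mul, abs_mul, abs_of_pos (by positivity : 0 < 4 / R), abs_of_nonneg e0]
          gcongr
          exact mul_le_of_le_one_right (by positivity) e1
        · rw [abs_mul, abs_of_nonneg (by positivity)]
          exact mul_le_of_le_one_left (abs_nonneg _) (pow_le_one₀ e0 e1)

open Module Set in
theorem lintegral_eq_lintegral_sphere_lintegral_Ioi {E : Type*} [NormedAddCommGroup E]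
    [NormedSpace ℝ E] [FiniteDimensional ℝ E] [Nontrivial E] [MeasurableSpace E] [BorelSpace E]
    (μ : Measure E) [μ.IsAddHaarMeasure] {f : E → ENNReal} (hf : Measurable f) :
    ∫⁻ x, f x ∂μ = ∫⁻ ω : Metric.sphere (0 : E) 1, ∫⁻ r : ℝ in Ioi (0 : ℝ),
      ENNReal.ofReal (r ^ (finrank ℝ E - 1)) * f (r • (ω : E)) ∂volume ∂μ.toSphere := by
  have hmp := μ.measurePreserving_homeomorphUnitSphereProd
  have hg : Measurable fun p : Metric.sphere (0 : E) 1 × Set.Ioi (0 : ℝ) =>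
      f ((p.2 : ℝ) • (p.1 : E)) := by
    fun_prop
  calc ∫⁻ x, f x ∂μ = ∫⁻ x : ({0}ᶜ : Set E), f x ∂(μ.comap (↑)) := by
        rw [lintegral_subtype_comap (measurableSet_singleton _).compl, restrict_compl_singleton]
    _ = ∫⁻ p, f ((p.2 : ℝ) • (p.1 : E)) ∂(μ.toSphere.prod (.volumeIoiPow (finrank ℝ E - 1))) := by
        rw [← hmp.lintegral_comp hg]
        refine lintegral_congr fun x => ?_
        simp [smul_smul, mul_inv_cancel₀ (norm_ne_zero_iff.2 (show (x : E) ≠ 0 from x.2))]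
    _ = _ := by
        rw [lintegral_prod _ hg.aemeasurable]
        refine lintegral_congr fun ω => ?_
        rw [Measure.volumeIoiPow, lintegral_withDensity_eq_lintegral_mul _ (by fun_prop)
          (by fun_prop)]
        exact lintegral_subtype_comap measurableSet_Ioi
          fun r : ℝ => ENNReal.ofReal (r ^ (finrank ℝ E - 1)) * f (r • (ω : E))

theorem ContDiff.pder {φ : (Fin 4 → ℝ) → ℝ} (hφ : ContDiff ℝ (⊤ : ℕ∞) φ) (α : Fin 4) :
    ContDiff ℝ (⊤ : ℕ∞) (pder α φ) :=
  (hφ.fderiv_right (by simp)).clm_apply contDiff_const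

theorem ContDiff.Lb {φ : (Fin 4 → ℝ) → ℝ} (hφ : ContDiff ℝ (⊤ : ℕ∞) φ) (a : Fin 3) :
    ContDiff ℝ (⊤ : ℕ∞) (Lb a φ) :=
  ((contDiff_apply ℝ ℝ a.succ).mul (hφ.pder 0)).add
    ((contDiff_apply ℝ ℝ 0).mul (hφ.pder a.succ))

theorem ContDiff.foldr_Lb {φ : (Fin 4 → ℝ) → ℝ} (hφ : ContDiff ℝ (⊤ : ℕ∞) φ) (l : List (Fin 3)) :
    ContDiff ℝ (⊤ : ℕ∞) (l.foldr _root_.Lb φ) := by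
  induction l with
  | nil => exact hφ
  | cons a l ih => exact ih.Lb a

theorem Lb_eq_zero {U : Set (Fin 4 → ℝ)} (hU : IsOpen U) {φ : (Fin 4 → ℝ) → ℝ}
    (hφ : ∀ y ∈ U, φ y = 0) (a : Fin 3) : ∀ y ∈ U, Lb a φ y = 0 := by
  intro y hy
  have : φ =ᶠ[nhds y] fun _ => 0 := by
    filter_upwards [hU.mem_nhds hy] with z hz using hφ z hz
  simp [Lb, pder, this.fderiv_eq]

theorem foldr_Lb_eq_zero {U : Set (Fin 4 → ℝ)} (hU : IsOpen U) {φ : (Fin 4 → ℝ) → ℝ}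
    (hφ : ∀ y ∈ U, φ y = 0) (l : List (Fin 3)) : ∀ y ∈ U, l.foldr Lb φ y = 0 := by
  induction l with
  | nil => exact hφ
  | cons a l ih => exact Lb_eq_zero hU ih a

theorem hypPoint_zero (s : ℝ) (x : Fin 3 → ℝ) :
    hypPoint s x 0 = √(s ^ 2 + ∑ i, x i ^ 2) := rfl

theorem hypPoint_succ (s : ℝ) (x : Fin 3 → ℝ) (a : Fin 3) : hypPoint s x a.succ = x a := rfl

theorem hypPoint_zero_pos {s : ℝ} (hs : 0 < s) (x : Fin 3 → ℝ) : 0 < hypPoint s x 0 := by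
  rw [hypPoint_zero]
  have : 0 ≤ ∑ i, x i ^ 2 := Finset.sum_nonneg fun i _ => sq_nonneg _
  positivity

theorem abs_le_hypPoint_zero (s : ℝ) (x : Fin 3 → ℝ) (a : Fin 3) : |x a| ≤ hypPoint s x 0 := by
  rw [hypPoint_zero]
  refine Real.abs_le_sqrt ?_
  have := Finset.single_le_sum (f := fun i => x i ^ 2) (fun i _ => sq_nonneg _) (Finset.mem_univ a)
  have := sq_nonneg s
  linarith

theorem continuous_hypPoint (s : ℝ) : Continuous (hypPoint s) := by
  refine continuous_pi fun i => ?_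
  induction i using Fin.cases with
  | zero => simp_rw [hypPoint_zero]; fun_prop
  | succ a => simp_rw [hypPoint_succ]; fun_prop

/-- The time coordinate on a hyperboloid is comparable along segments that are short relative
to it. -/
theorem hypPoint_zero_le_two_mul {s : ℝ} (hs : 0 < s) (x ω : Fin 3 → ℝ) (hω : ∀ a, |ω a| ≤ 1)
    {r : ℝ} (hr : 0 ≤ r) (hr' : r ≤ hypPoint s x 0 / 4) :
    hypPoint s x 0 ≤ 2 * hypPoint s (x + r • ω) 0 := by
  set t := hypPoint s x 0 with ht
  have ht0 : 0 < t := hypPoint_zero_pos hs x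
  have hsq : t ^ 2 = s ^ 2 + ∑ i, x i ^ 2 := by
    rw [ht, hypPoint_zero, Real.sq_sqrt]
    have : 0 ≤ ∑ i, x i ^ 2 := Finset.sum_nonneg fun i _ => sq_nonneg _
    positivity
  have hi : ∀ i, x i ^ 2 / 2 - (t / 4) ^ 2 ≤ (x i + r * ω i) ^ 2 := fun i => by
    have : (r * ω i) ^ 2 ≤ (t / 4) ^ 2 := by
      rw [← sq_abs, abs_mul, abs_of_nonneg hr]
      gcongr
      exact (mul_le_of_le_one_right hr (hω i)).trans hr'
    nlinarith [sq_nonneg (x i + 2 * (r * ω i))]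
  have : t / 2 ≤ hypPoint s (x + r • ω) 0 := by
    rw [hypPoint_zero]
    refine Real.le_sqrt_of_sq_le ?_
    simp only [Fin.sum_univ_three, Pi.add_apply, Pi.smul_apply, smul_eq_mul] at hsq ⊢
    nlinarith [hi 0, hi 1, hi 2, sq_nonneg s]
  linarith

theorem hasDerivAt_hypPoint_zero {s : ℝ} (hs : 0 < s) (x ω : Fin 3 → ℝ) (r : ℝ) :
    HasDerivAt (fun r : ℝ => hypPoint s (x + r • ω) 0)
      ((∑ a, ω a * (x + r • ω) a) / hypPoint s (x + r • ω) 0) r := by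
  have h1 : HasDerivAt (fun r : ℝ => s ^ 2 + ∑ i, (x + r • ω) i ^ 2)
      (∑ i, 2 * ((x + r • ω) i * ω i)) r := by
    refine (HasDerivAt.fun_sum fun i _ => ?_).const_add _
    have : HasDerivAt (fun r : ℝ => (x + r • ω) i) (ω i) r := by
      simpa using ((hasDerivAt_id r).mul_const (ω i)).const_add (x i)
    simpa [mul_assoc] using this.fun_pow 2
  have hpos := hypPoint_zero_pos hs (x + r • ω)
  rw [hypPoint_zero] at hpos
  refine (h1.sqrt (Real.sqrt_pos.1 hpos).ne').congr_deriv ?_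
  rw [hypPoint_zero, ← Finset.mul_sum, mul_div_mul_left _ _ two_ne_zero]
  simp_rw [mul_comm (ω _)]

/-- The Lorentz boosts are tangent to the hyperboloids, where they act as `t ∂_a`. -/
theorem hasDerivAt_comp_hypPoint {s : ℝ} (hs : 0 < s) {φ : (Fin 4 → ℝ) → ℝ}
    (hφ : Differentiable ℝ φ) (x ω : Fin 3 → ℝ) (r : ℝ) :
    HasDerivAt (fun r : ℝ => φ (hypPoint s (x + r • ω)))
      ((∑ a, ω a * Lb a φ (hypPoint s (x + r • ω))) / hypPoint s (x + r • ω) 0) r := by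
  have hpos := hypPoint_zero_pos hs (x + r • ω)
  have h1 : HasDerivAt (fun r : ℝ => hypPoint s (x + r • ω))
      (Fin.cons ((∑ a, ω a * (x + r • ω) a) / hypPoint s (x + r • ω) 0) ω) r := by
    refine hasDerivAt_pi.2 fun i => ?_
    induction i using Fin.cases with
    | zero => exact hasDerivAt_hypPoint_zero hs x ω r
    | succ a =>
      simp only [hypPoint_succ, Fin.cons_succ]
      simpa using ((hasDerivAt_id r).mul_const (ω a)).const_add (x a)
  refine ((hφ _).hasFDerivAt.comp_hasDerivAt r h1).congr_deriv ?_
  have h2 : ∀ (y v : Fin 4 → ℝ), fderiv ℝ φ y v = ∑ α, v α * pder α φ y := fun y v => by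
    conv_lhs => rw [pi_eq_sum_univ' v]
    simp only [map_sum, map_smul, smul_eq_mul, pder]
  rw [h2, Fin.sum_univ_succ]
  simp only [Fin.cons_zero, Fin.cons_succ, Lb, hypPoint_succ, Fin.sum_univ_three]
  field_simp
  ring

/-- The sum of `G` over the words of length at most two in three letters. -/
def wordSum (G : List (Fin 3) → ℝ) : ℝ :=
  ∑ n ∈ Finset.range 3, ∑ J : Fin n → Fin 3, G (List.ofFn J)

theorem wordSum_eq (G : List (Fin 3) → ℝ) :
    wordSum G = G [] + ∑ a, G [a] + ∑ a, ∑ b, G [b, a] := by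
  have h1 : ∑ J : Fin 1 → Fin 3, G (List.ofFn J) = ∑ a, G [a] :=
    Fintype.sum_equiv (Equiv.funUnique (Fin 1) (Fin 3)) _ _ fun J => by simp
  have h2 : ∑ J : Fin 2 → Fin 3, G (List.ofFn J) = ∑ a, ∑ b, G [b, a] := by
    rw [Finset.sum_comm, ← Fintype.sum_prod_type']
    exact Fintype.sum_equiv (finTwoArrowEquiv (Fin 3)) _ _ fun J => by simp
  rw [wordSum, Finset.sum_range_succ, Finset.sum_range_succ, Finset.sum_range_one, h1, h2]
  simp

theorem wordSum_sq_le (G : List (Fin 3) → ℝ) : wordSum G ^ 2 ≤ 27 * wordSum fun l => G l ^ 2 := by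
  calc wordSum G ^ 2 ≤ 3 * ∑ n ∈ Finset.range 3, (∑ J : Fin n → Fin 3, G (List.ofFn J)) ^ 2 := by
        simpa [wordSum] using sq_sum_le_card_mul_sum_sq (s := Finset.range 3)
          (f := fun n => ∑ J : Fin n → Fin 3, G (List.ofFn J))
    _ ≤ 3 * ∑ n ∈ Finset.range 3, 9 * ∑ J : Fin n → Fin 3, G (List.ofFn J) ^ 2 := by
        gcongr with n hn
        refine sq_sum_le_card_mul_sum_sq.trans ?_
        gcongr
        have : n ≤ 2 := Nat.le_of_lt_succ (Finset.mem_range.1 hn)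
        simpa using (pow_le_pow_right₀ (by norm_num : (1 : ℝ) ≤ 3) this).trans (by norm_num)
    _ = 27 * wordSum fun l => G l ^ 2 := by
        rw [wordSum, ← Finset.mul_sum]; ring

theorem wordSum_le_sq_wordSum_sqrt {G : List (Fin 3) → ℝ} (hG : ∀ l, 0 ≤ G l) :
    wordSum G ≤ (wordSum fun l => √(G l)) ^ 2 := by
  calc wordSum G = ∑ n ∈ Finset.range 3, ∑ J : Fin n → Fin 3, √(G (List.ofFn J)) ^ 2 := by
        simp_rw [Real.sq_sqrt (hG _)]; rfl
    _ ≤ ∑ n ∈ Finset.range 3, (∑ J : Fin n → Fin 3, √(G (List.ofFn J))) ^ 2 := by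
        gcongr
        exact Finset.sum_sq_le_sq_sum_of_nonneg fun _ _ => Real.sqrt_nonneg _
    _ ≤ _ := Finset.sum_sq_le_sq_sum_of_nonneg fun _ _ =>
        Finset.sum_nonneg fun _ _ => Real.sqrt_nonneg _

theorem abs_sum_mul_le_sum_abs {ι : Type*} [Fintype ι] {ω f : ι → ℝ} (hω : ∀ a, |ω a| ≤ 1) :
    |∑ a, ω a * f a| ≤ ∑ a, |f a| :=
  (Finset.abs_sum_le_sum_abs _ _).trans <| Finset.sum_le_sum fun a _ => by
    rw [abs_mul]; exact mul_le_of_le_one_left (abs_nonneg _) (hω a)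

theorem hypPoint_zero_pow_mul_sq_le_integral {s : ℝ} (hs : 0 < s) {u : (Fin 4 → ℝ) → ℝ}
    (hu : ContDiff ℝ (⊤ : ℕ∞) u) (x ω : Fin 3 → ℝ) (hω : ∀ a, |ω a| ≤ 1) :
    hypPoint s x 0 ^ 3 * u (hypPoint s x) ^ 2 ≤ 13068 * ∫ r in (0 : ℝ)..hypPoint s x 0 / 4,
      r ^ 2 * wordSum fun l => l.foldr Lb u (hypPoint s (x + r • ω)) ^ 2 := by
  set t := hypPoint s x 0 with ht
  have ht0 : 0 < t := hypPoint_zero_pos hs x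
  set H : ℝ → Fin 4 → ℝ := fun r => hypPoint s (x + r • ω) with hH
  have cH : Continuous H := (continuous_hypPoint s).comp (by fun_prop)
  have hT : ∀ r, 0 < H r 0 := fun r => hypPoint_zero_pos hs _
  have hT' : ∀ r, H r 0 ≠ 0 := fun r => (hT r).ne'
  have hdiff : ∀ l : List (Fin 3), Differentiable ℝ (l.foldr Lb u) := fun l =>
    (hu.foldr_Lb l).differentiable (by simp)
  have cL : ∀ l : List (Fin 3), Continuous fun r => l.foldr Lb u (H r) := fun l =>
    (hdiff l).continuous.comp cH
  set N : ℝ → ℝ := fun r => ∑ a, ω a * [a].foldr Lb u (H r) with hN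
  set N' : ℝ → ℝ := fun r => ∑ a, ω a * ((∑ b, ω b * [b, a].foldr Lb u (H r)) / H r 0) with hN'
  set T' : ℝ → ℝ := fun r => (∑ a, ω a * (x + r • ω) a) / H r 0 with hT'def
  have dN : ∀ r, HasDerivAt N (N' r) r := fun r =>
    HasDerivAt.fun_sum fun a _ => (hasDerivAt_comp_hypPoint hs (hdiff [a]) x ω r).const_mul _
  have dT : ∀ r, HasDerivAt (fun r => H r 0) (T' r) r := hasDerivAt_hypPoint_zero hs x ω
  have cT : Continuous fun r => H r 0 := (continuous_apply 0).comp cH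
  have cN : Continuous N := continuous_finsetSum _ fun a _ => continuous_const.mul (cL [a])
  have cN' : Continuous N' := continuous_finsetSum _ fun a _ => continuous_const.mul <|
    (continuous_finsetSum _ fun b _ => continuous_const.mul (cL [b, a])).div cT hT'
  have cT' : Continuous T' := Continuous.div (by fun_prop) cT hT'
  have cq : Continuous fun r => wordSum fun l => l.foldr Lb u (H r) ^ 2 :=
    continuous_finsetSum _ fun n _ => continuous_finsetSum _ fun J _ => (cL _).pow 2
  have main := sq_le_integral_sq_mul_of_hasDerivAt (R := t / 4) (f := fun r => u (H r))
    (f' := fun r => N r / H r 0) (f'' := fun r => (N' r * H r 0 - N r * T' r) / H r 0 ^ 2)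
    (q := fun r => 52272 / t ^ 4 * wordSum fun l => l.foldr Lb u (H r) ^ 2)
    (by positivity) (fun r => hasDerivAt_comp_hypPoint hs (hdiff []) x ω r)
    (fun r => (dN r).div (dT r) (hT' r))
    (((cN'.mul cT).sub (cN.mul cT')).div (cT.pow 2) fun r => pow_ne_zero _ (hT' r))
    (continuous_const.mul cq) ?_
  · have e : ∀ r : ℝ, r ^ 2 * (52272 / t ^ 4 * wordSum fun l => l.foldr Lb u (H r) ^ 2)
        = 52272 / t ^ 4 * (r ^ 2 * wordSum fun l => l.foldr Lb u (H r) ^ 2) := fun r => by ring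
    simp_rw [e] at main
    rw [intervalIntegral.integral_const_mul] at main
    have h0 : H 0 = hypPoint s x := by simp [hH]
    simp only [h0] at main
    calc t ^ 3 * u (hypPoint s x) ^ 2 ≤ t ^ 3 * _ :=
          mul_le_mul_of_nonneg_left main (by positivity)
      _ = _ := by field_simp; norm_num; rfl
  · intro r hr
    set S0 := |u (H r)|
    set S1 := ∑ a, |[a].foldr Lb u (H r)|
    set S2 := ∑ a, ∑ b, |[b, a].foldr Lb u (H r)|
    have hS0n : 0 ≤ S0 := abs_nonneg _
    have hS1n : 0 ≤ S1 := Finset.sum_nonneg fun _ _ => abs_nonneg _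
    have hS2n : 0 ≤ S2 := Finset.sum_nonneg fun _ _ => Finset.sum_nonneg fun _ _ => abs_nonneg _
    have hS : wordSum (fun l => |l.foldr Lb u (H r)|) = S0 + S1 + S2 := wordSum_eq _
    have tT : t ≤ 2 * H r 0 := hypPoint_zero_le_two_mul hs x ω hω hr.1 hr.2
    have hinv : 1 / H r 0 ≤ 2 / t := by
      rw [div_le_div_iff₀ (hT r) ht0]; linarith
    have bN : |N r| ≤ S1 := abs_sum_mul_le_sum_abs hω
    have bN' : |N' r * H r 0| ≤ S2 := by
      have : N' r * H r 0 = ∑ a, ω a * ∑ b, ω b * [b, a].foldr Lb u (H r) := by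
        rw [hN', Finset.sum_mul]
        refine Finset.sum_congr rfl fun a _ => ?_
        rw [mul_assoc, div_mul_cancel₀ _ (hT' r)]
      rw [this]
      exact (abs_sum_mul_le_sum_abs hω).trans
        (Finset.sum_le_sum fun a _ => abs_sum_mul_le_sum_abs hω)
    have bT' : |T' r| ≤ 3 := by
      rw [hT'def, abs_div, abs_of_pos (hT r), div_le_iff₀ (hT r)]
      refine (abs_sum_mul_le_sum_abs hω).trans ?_
      refine (Finset.sum_le_sum fun a _ => abs_le_hypPoint_zero s (x + r • ω) a).trans ?_
      simp [hH]
    have b1 : |N r / H r 0| ≤ 2 / t * S1 := by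
      rw [abs_div, abs_of_pos (hT r), div_eq_mul_one_div, mul_comm]
      gcongr
    have b2 : |(N' r * H r 0 - N r * T' r) / H r 0 ^ 2| ≤ 4 / t ^ 2 * (S2 + 3 * S1) := by
      have e1 : (1 / H r 0) ^ 2 ≤ 4 / t ^ 2 := by
        calc (1 / H r 0) ^ 2 ≤ (2 / t) ^ 2 := by have := hT r; gcongr
          _ = 4 / t ^ 2 := by ring
      have e2 : |N' r * H r 0 - N r * T' r| ≤ S2 + 3 * S1 := by
        refine (abs_sub _ _).trans (add_le_add bN' ?_)
        rw [abs_mul, mul_comm]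
        gcongr
      rw [abs_div, abs_of_pos (pow_pos (hT r) 2), div_eq_mul_one_div, mul_comm,
        ← one_div_pow]
      gcongr
    have key : 2 / (t / 4) ^ 2 * S0 + 4 / (t / 4) * |N r / H r 0|
        + |(N' r * H r 0 - N r * T' r) / H r 0 ^ 2| ≤ 44 / t ^ 2 * (S0 + S1 + S2) := by
      calc _ ≤ 2 / (t / 4) ^ 2 * S0 + 4 / (t / 4) * (2 / t * S1) + 4 / t ^ 2 * (S2 + 3 * S1) := by
            gcongr
        _ = (32 * S0 + 44 * S1 + 4 * S2) / t ^ 2 := by field_simp; ring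
        _ ≤ (44 * (S0 + S1 + S2)) / t ^ 2 := by gcongr; linarith
        _ = _ := by ring
    calc _ ≤ (44 / t ^ 2 * (S0 + S1 + S2)) ^ 2 := by gcongr
      _ = 44 ^ 2 / t ^ 4 * wordSum (fun l => |l.foldr Lb u (H r)|) ^ 2 := by rw [hS]; ring
      _ ≤ 44 ^ 2 / t ^ 4 * (27 * wordSum fun l => |l.foldr Lb u (H r)| ^ 2) := by
          gcongr; exact wordSum_sq_le _
      _ = _ := by simp_rw [sq_abs]; ring

open Set in
theorem mul_toSphere_le_integral {E : Type*} [NormedAddCommGroup E] [NormedSpace ℝ E]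
    [FiniteDimensional ℝ E] [Nontrivial E] [MeasurableSpace E] [BorelSpace E]
    (μ : Measure E) [μ.IsAddHaarMeasure] {Q : E → ℝ} (hQ : Continuous Q) (hQi : Integrable Q μ)
    (hQ0 : ∀ y, 0 ≤ Q y) (x : E) {R M : ℝ} (hR : 0 ≤ R)
    (hM : ∀ ω : E, ‖ω‖ = 1 →
      M ≤ ∫ r in (0 : ℝ)..R, r ^ (Module.finrank ℝ E - 1) * Q (x + r • ω)) :
    M * μ.toSphere.real univ ≤ ∫ y, Q y ∂μ := by
  have hω : ∀ ω : Metric.sphere (0 : E) 1, ENNReal.ofReal M ≤ ∫⁻ r : ℝ in Ioi (0 : ℝ),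
      ENNReal.ofReal (r ^ (Module.finrank ℝ E - 1)) * ENNReal.ofReal (Q (x + r • (ω : E))) := by
    intro ω
    have hint : IntervalIntegrable (fun r : ℝ => r ^ (Module.finrank ℝ E - 1) * Q (x + r • (ω : E)))
      volume 0 R := Continuous.intervalIntegrable (by fun_prop) _ _
    calc ENNReal.ofReal M ≤ ENNReal.ofReal
          (∫ r in Ioc 0 R, r ^ (Module.finrank ℝ E - 1) * Q (x + r • (ω : E))) := by
          rw [← intervalIntegral.integral_of_le hR]
          exact ENNReal.ofReal_le_ofReal (hM ω (by simp))
      _ = ∫⁻ r in Ioc 0 R, ENNReal.ofReal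
            (r ^ (Module.finrank ℝ E - 1) * Q (x + r • (ω : E))) := by
          refine ofReal_integral_eq_lintegral_ofReal hint.1 ?_
          filter_upwards [ae_restrict_mem measurableSet_Ioc] with r hr
          exact mul_nonneg (pow_nonneg hr.1.le _) (hQ0 _)
      _ = ∫⁻ r in Ioc 0 R, ENNReal.ofReal (r ^ (Module.finrank ℝ E - 1)) *
            ENNReal.ofReal (Q (x + r • (ω : E))) :=
          lintegral_congr fun r => ENNReal.ofReal_mul' (hQ0 _)
      _ ≤ _ := lintegral_mono_set Ioc_subset_Ioi_self
  have h : ENNReal.ofReal (M * μ.toSphere.real univ) ≤ ENNReal.ofReal (∫ y, Q y ∂μ) := by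
    calc ENNReal.ofReal (M * μ.toSphere.real univ)
        = ∫⁻ _ : Metric.sphere (0 : E) 1, ENNReal.ofReal M ∂μ.toSphere := by
          rw [lintegral_const, ENNReal.ofReal_mul' measureReal_nonneg, ofReal_measureReal]
      _ ≤ _ := lintegral_mono hω
      _ = ∫⁻ y, ENNReal.ofReal (Q (x + y)) ∂μ :=
          (lintegral_eq_lintegral_sphere_lintegral_Ioi μ
            (f := fun y => ENNReal.ofReal (Q (x + y))) (by fun_prop)).symm
      _ = ∫⁻ y, ENNReal.ofReal (Q y) ∂μ :=
          lintegral_add_left_eq_self (fun y => ENNReal.ofReal (Q y)) x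
      _ = ENNReal.ofReal (∫ y, Q y ∂μ) :=
          (ofReal_integral_eq_lintegral_ofReal hQi (.of_forall hQ0)).symm
  exact (ENNReal.ofReal_le_ofReal_iff (integral_nonneg hQ0)).1 h

theorem integrable_sq_foldr_Lb_hypPoint {s : ℝ} {u : (Fin 4 → ℝ) → ℝ}
    (hu : ContDiff ℝ (⊤ : ℕ∞) u)
    (hsupp : ∀ t : ℝ, ∀ x : Fin 3 → ℝ, t - 1 ≤ rad x → u (spt t x) = 0) (l : List (Fin 3)) :
    Integrable fun x => l.foldr Lb u (hypPoint s x) ^ 2 := by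
  have hrad : Continuous rad := by unfold rad; fun_prop
  have hU : IsOpen {y : Fin 4 → ℝ | y 0 - 1 < rad (Fin.tail y)} :=
    isOpen_lt (by fun_prop) (hrad.comp (by unfold Fin.tail; fun_prop))
  have hz := foldr_Lb_eq_zero hU (fun y hy => by
    rw [← Fin.cons_self_tail y]; exact hsupp _ _ hy.le) l
  refine Continuous.integrable_of_hasCompactSupport
    (((hu.foldr_Lb l).continuous.comp (continuous_hypPoint s)).pow 2)
    (HasCompactSupport.intro (isCompact_closedBall 0 (s ^ 2)) fun x hx => ?_)
  have hx : s ^ 2 < ‖x‖ := by simpa using hx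
  have hle : ‖x‖ ≤ rad x := (pi_norm_le_iff_of_nonneg (Real.sqrt_nonneg _)).2 fun i =>
    Real.abs_le_sqrt (Finset.single_le_sum (f := fun i => x i ^ 2)
      (fun i _ => sq_nonneg _) (Finset.mem_univ i))
  suffices l.foldr Lb u (hypPoint s x) = 0 by simp [this]
  refine hz _ ?_
  have hsq : rad x ^ 2 = ∑ i, x i ^ 2 := Real.sq_sqrt (Finset.sum_nonneg fun i _ => sq_nonneg _)
  have h0 : 0 ≤ s ^ 2 := sq_nonneg s
  have : √(s ^ 2 + ∑ i, x i ^ 2) < rad x + 1 := by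
    rw [Real.sqrt_lt' (by linarith), ← hsq]
    nlinarith
  show √(s ^ 2 + ∑ i, x i ^ 2) - 1 < rad x
  linarith

/-- Sobolev inequality on hyperboloids:
`t^{3/2}|u(t,x)| ≤ C Σ_{|J|≤2} ‖L^J u‖_{L²_f(H_s)}` on `H_s`, for `u` supported in `{r < t-1}`. -/
theorem sobolev_on_hyperboloids :
    ∃ C : ℝ, 0 < C ∧
      ∀ u : (Fin 4 → ℝ) → ℝ, ContDiff ℝ (⊤ : ℕ∞) u →
        (∀ t : ℝ, ∀ x : Fin 3 → ℝ, t - 1 ≤ rad x → u (spt t x) = 0) →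
        ∀ s : ℝ, 2 ≤ s → ∀ x : Fin 3 → ℝ,
          (hypPoint s x 0) ^ ((3:ℝ)/2) * |u (hypPoint s x)|
            ≤ C * ∑ n ∈ Finset.range 3, ∑ J : Fin n → Fin 3,
                Real.sqrt (hypL2Sq s (applyBoosts J u)) := by
  set σ := (volume : Measure (Fin 3 → ℝ)).toSphere.real Set.univ with hσdef
  have hσ : 0 < σ := by
    rw [hσdef, measureReal_def, ENNReal.toReal_pos_iff]
    exact ⟨Measure.measure_univ_pos.2 (Measure.toSphere_ne_zero _), measure_lt_top _ _⟩
  refine ⟨√(13068 / σ), by positivity, fun u hu hsupp s hs x => ?_⟩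
  have hs0 : 0 < s := by linarith
  set t := hypPoint s x 0
  have ht0 : 0 < t := hypPoint_zero_pos hs0 x
  have hint := integrable_sq_foldr_Lb_hypPoint (s := s) hu hsupp
  have hintegral : ∫ y, wordSum (fun l => l.foldr Lb u (hypPoint s y) ^ 2)
      = wordSum fun l => hypL2Sq s (l.foldr Lb u) := by
    unfold wordSum
    rw [integral_finsetSum _ fun n _ => integrable_finsetSum _ fun J _ => hint _]
    refine Finset.sum_congr rfl fun n _ => ?_
    rw [integral_finsetSum _ fun J _ => hint _]
    rfl
  have key := mul_toSphere_le_integral (volume : Measure (Fin 3 → ℝ))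
    (Q := fun y => wordSum fun l => l.foldr Lb u (hypPoint s y) ^ 2)
    (continuous_finsetSum _ fun n _ => continuous_finsetSum _ fun J _ =>
      ((hu.foldr_Lb _).continuous.comp (continuous_hypPoint s)).pow 2)
    (integrable_finsetSum _ fun n _ => integrable_finsetSum _ fun J _ => hint _)
    (fun y => Finset.sum_nonneg fun n _ => Finset.sum_nonneg fun J _ => sq_nonneg _)
    x (R := t / 4) (M := t ^ 3 * u (hypPoint s x) ^ 2 / 13068) (by positivity) fun ω hω => by
      rw [div_le_iff₀' (by norm_num)]
      simpa using hypPoint_zero_pow_mul_sq_le_integral hs0 hu x ω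
        fun a => (norm_le_pi_norm ω a).trans hω.le
  rw [hintegral] at key
  have hL : ∀ l : List (Fin 3), 0 ≤ hypL2Sq s (l.foldr Lb u) := fun l =>
    integral_nonneg fun y => sq_nonneg _
  have hS := wordSum_le_sq_wordSum_sqrt hL
  set S := wordSum fun l => √(hypL2Sq s (l.foldr Lb u))
  have hS0 : 0 ≤ S := Finset.sum_nonneg fun n _ => Finset.sum_nonneg fun J _ => Real.sqrt_nonneg _
  change t ^ ((3 : ℝ) / 2) * |u (hypPoint s x)| ≤ √(13068 / σ) * S
  refine abs_le_of_sq_le_sq' ?_ (by positivity) |>.2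
  have e : (t ^ ((3 : ℝ) / 2)) ^ 2 = t ^ 3 := by
    rw [← Real.rpow_natCast, ← Real.rpow_mul ht0.le, ← Real.rpow_natCast]
    norm_num
  rw [mul_pow, mul_pow, e, sq_abs, Real.sq_sqrt (by positivity), div_mul_eq_mul_div,
    le_div_iff₀ hσ]
  have := key.trans hS
  linarith
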